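/- Let X be a finite set with a weight function w : X → ℝ≥0, extended to subsets by w(A) = Σ_{x∈A} w(x), let 𝒮 be a nonempty finite family of subsets of X, and let k ≥ 1 be an integer. Let OPT = max{ w(A₁ ∪ … ∪ A_k) : A₁,…,A_k ∈ 𝒮 }. Suppose T₁,…,T_k ∈ 𝒮 is a greedy sequence, i.e., for each i, T_{i+1} maximizes w(A ∖ (T₁ ∪ … ∪ T_i)) over all A ∈ 𝒮. Then w(T₁ ∪ … ∪ T_k) ≥ (1 − (1 − 1/k)^k)·OPT. -/

import Mathlib

open Finset

/-- The union of the first `i` sets chosen by the greedy algorithm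
(`T j` for indices `j` with `(j : ℕ) < i`). -/
def prefixUnion {α : Type*} [DecidableEq α] {k : ℕ} (T : Fin k → Finset α) (i : ℕ) :
    Finset α :=
  (Finset.univ.filter (fun j : Fin k => (j : ℕ) < i)).biUnion T

/-- A nonnegative sum over a finite union is at most the sum of the sums over its members. -/
theorem sum_biUnion_le_sum_sum {α ι : Type*} [DecidableEq α] {f : α → ℝ}
    (hf : ∀ x, 0 ≤ f x) (s : Finset ι) (A : ι → Finset α) :
    ∑ x ∈ s.biUnion A, f x ≤ ∑ i ∈ s, ∑ x ∈ A i, f x := by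
  classical
  induction s using Finset.induction_on with
  | empty => simp
  | insert a s ha ih =>
    rw [Finset.sum_insert ha, Finset.biUnion_insert]
    have hunion := Finset.sum_union_inter (s₁ := A a) (s₂ := s.biUnion A) (f := f)
    have hinter := Finset.sum_nonneg fun x (_ : x ∈ A a ∩ s.biUnion A) => hf x
    linarith

/-- A nonnegative sum over a finite union is at most the sum over `P` plus the sums over the parts
of its members outside `P`. -/
theorem sum_biUnion_le_sum_add_sum_sdiff {α ι : Type*} [DecidableEq α] {f : α → ℝ}
    (hf : ∀ x, 0 ≤ f x) (s : Finset ι) (A : ι → Finset α) (P : Finset α) :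
    ∑ x ∈ s.biUnion A, f x ≤ ∑ x ∈ P, f x + ∑ i ∈ s, ∑ x ∈ A i \ P, f x := by
  have hsub : s.biUnion A ⊆ P ∪ s.biUnion fun i => A i \ P := by
    intro x hx
    simp only [Finset.mem_union, Finset.mem_biUnion, Finset.mem_sdiff] at hx ⊢
    grind
  have hle := Finset.sum_le_sum_of_subset_of_nonneg hsub fun x _ _ => hf x
  have hunion := Finset.sum_union_inter (s₁ := P) (s₂ := s.biUnion fun i => A i \ P) (f := f)
  have hinter := Finset.sum_nonneg
    fun x (_ : x ∈ P ∩ s.biUnion fun i => A i \ P) => hf x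
  have hparts := sum_biUnion_le_sum_sum hf s fun i => A i \ P
  linarith

theorem prefixUnion_zero {α : Type*} [DecidableEq α] {k : ℕ} (T : Fin k → Finset α) :
    prefixUnion T 0 = ∅ := by
  simp [prefixUnion]

theorem prefixUnion_self {α : Type*} [DecidableEq α] {k : ℕ} (T : Fin k → Finset α) :
    prefixUnion T k = Finset.univ.biUnion T := by
  simp [prefixUnion]

theorem prefixUnion_succ {α : Type*} [DecidableEq α] {k : ℕ} (T : Fin k → Finset α)
    (i : Fin k) : prefixUnion T ((i : ℕ) + 1) = prefixUnion T i ∪ T i := by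
  ext x
  simp only [prefixUnion, Finset.mem_union, Finset.mem_biUnion, Finset.mem_filter,
    Finset.mem_univ, true_and]
  constructor
  · rintro ⟨j, hj, hx⟩
    rcases Nat.lt_succ_iff_lt_or_eq.mp hj with h | h
    · exact Or.inl ⟨j, h, hx⟩
    · exact Or.inr (Fin.ext h ▸ hx)
  · rintro (⟨j, hj, hx⟩ | hx)
    · exact ⟨j, by omega, hx⟩
    · exact ⟨i, by omega, hx⟩

/-- **Greedy approximation for Weighted Maximum Coverage, sharp form.**
Let `X` be a finite universe with nonnegative weights `w`, `𝒮` a nonempty family of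
subsets, and `k ≥ 1`.  If `T 0, …, T (k-1) ∈ 𝒮` is a greedy sequence (each `T i`
maximizes the weight of newly covered elements over all members of `𝒮`), then the
weight covered by the greedy sets is at least `(1 - (1 - 1/k)^k)` times the weight
covered by any choice of `k` sets from `𝒮` — in particular at least
`(1 - (1 - 1/k)^k) · OPT`. -/
theorem greedy_wmcp_sharp
    {α : Type*} [DecidableEq α] (w : α → NNReal)
    (𝒮 : Finset (Finset α)) (h𝒮 : 𝒮.Nonempty)
    (k : ℕ) (hk : 1 ≤ k)
    (T : Fin k → Finset α) (hT : ∀ i, T i ∈ 𝒮)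
    (hgreedy : ∀ i : Fin k, ∀ A ∈ 𝒮,
      ∑ x ∈ A \ prefixUnion T (i : ℕ), (w x : ℝ) ≤
        ∑ x ∈ T i \ prefixUnion T (i : ℕ), (w x : ℝ))
    (A : Fin k → Finset α) (hA : ∀ i, A i ∈ 𝒮) :
    (1 - (1 - 1 / (k : ℝ)) ^ k) * ∑ x ∈ Finset.univ.biUnion A, (w x : ℝ) ≤
      ∑ x ∈ Finset.univ.biUnion T, (w x : ℝ) := by
  have hw : ∀ x, (0 : ℝ) ≤ w x := fun x => (w x).2
  have hk0 : (0 : ℝ) < k := by exact_mod_cast hk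
  have hr : (0 : ℝ) ≤ 1 - 1 / (k : ℝ) := by
    rw [sub_nonneg, div_le_one hk0]
    exact_mod_cast hk
  set opt := ∑ x ∈ Finset.univ.biUnion A, (w x : ℝ)
  have hgap : ∀ i ≤ k,
      opt - ∑ x ∈ prefixUnion T i, (w x : ℝ) ≤ (1 - 1 / (k : ℝ)) ^ i * opt := by
    intro i
    induction i with
    | zero => simp [prefixUnion_zero]
    | succ i ih =>
      intro hi
      let j : Fin k := ⟨i, hi⟩
      have hcover := sum_biUnion_le_sum_add_sum_sdiff hw Finset.univ A (prefixUnion T i)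
      have hgain : ∑ l, ∑ x ∈ A l \ prefixUnion T i, (w x : ℝ) ≤
          k * ∑ x ∈ T j \ prefixUnion T i, (w x : ℝ) := by
        simpa using Finset.sum_le_sum fun l (_ : l ∈ Finset.univ) => hgreedy j (A l) (hA l)
      have hsucc : ∑ x ∈ prefixUnion T (i + 1), (w x : ℝ) =
          ∑ x ∈ prefixUnion T i, (w x : ℝ) + ∑ x ∈ T j \ prefixUnion T i, (w x : ℝ) := by
        rw [show prefixUnion T (i + 1) = prefixUnion T i ∪ T j from prefixUnion_succ T j,
          ← Finset.union_sdiff_self_eq_union, Finset.sum_union Finset.disjoint_sdiff]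
      have hstep : (opt - ∑ x ∈ prefixUnion T i, (w x : ℝ)) / k ≤
          ∑ x ∈ T j \ prefixUnion T i, (w x : ℝ) := by
        rw [div_le_iff₀' hk0]
        linarith
      calc opt - ∑ x ∈ prefixUnion T (i + 1), (w x : ℝ)
          ≤ (1 - 1 / (k : ℝ)) * (opt - ∑ x ∈ prefixUnion T i, (w x : ℝ)) := by
            rw [hsucc, sub_mul, one_mul, one_div_mul_eq_div]
            linarith
        _ ≤ (1 - 1 / (k : ℝ)) * ((1 - 1 / (k : ℝ)) ^ i * opt) :=
            mul_le_mul_of_nonneg_left (ih (by omega)) hr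
        _ = (1 - 1 / (k : ℝ)) ^ (i + 1) * opt := by ring
  have hfinal := hgap k le_rfl
  rw [prefixUnion_self] at hfinal
  linarith
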